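/- arXiv:2210.02292 — 2 statements merged into one kernel-verified Lean document; each statement's English description precedes it below -/
import Mathlib

section
/- Let s be a non-empty string. Let t = sufpal(s,|s|), the longest palindromic suffix of s, let t' = link(t), and let s' = s[1..|s|−1]. Then for all 1 ≤ i ≤ |s'|: presurf(s',i) = t' if i = |s| − |t| + 1 and |sufsurf(s, |s| − |t| + |t'|)| < |t'|; presurf(s',i) = ε if i = |s| − |t| + 1 and |sufsurf(s, |s| − |t| + |t'|)| ≥ |t'|; and presurf(s',i) = presurf(s,i) otherwise. Moreover, sufsurf(s',i) = t' if i = |s| − |t| + |t'| and |sufsurf(s, |s| − |t| + |t'|)| < |t'|, and sufsurf(s',i) = sufsurf(s,i) otherwise. -/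
noncomputable section
open scoped Classical

namespace DEE

variable {α : Type*}

/-- 1-indexed substring `s[i..j]` (empty if `i > j`). -/
def substr (s : List α) (i j : ℕ) : List α := (s.drop (i - 1)).take (j + 1 - i)

/-- Set of start positions (1-indexed) of occurrences of `t` in `s`. -/
def occ (s t : List α) : Set ℕ :=
  {i | 1 ≤ i ∧ i + t.length - 1 ≤ s.length ∧ (s.drop (i - 1)).take t.length = t}

/-- `v` is a non-empty palindromic substring of `s`. -/
def IsPalSub (s v : List α) : Prop := v ≠ [] ∧ v.Palindrome ∧ v <:+: s

/-- `prelen s i`: length of the longest palindromic prefix of `s[i..|s|]`. -/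
def prelen (s : List α) (i : ℕ) : ℕ :=
  sSup {l | 1 ≤ l ∧ l ≤ s.length + 1 - i ∧ (substr s i (i + l - 1)).Palindrome}

/-- `suflen s i`: length of the longest palindromic suffix of `s[1..i]`. -/
def suflen (s : List α) (i : ℕ) : ℕ :=
  sSup {l | 1 ≤ l ∧ l ≤ i ∧ (substr s (i + 1 - l) i).Palindrome}

/-- longest palindromic prefix of `s[i..|s|]`. -/
def prepal (s : List α) (i : ℕ) : List α := substr s i (i + prelen s i - 1)

/-- longest palindromic suffix of `s[1..i]`. -/
def sufpal (s : List α) (i : ℕ) : List α := substr s (i + 1 - suflen s i) i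

/-- The occurrence `s[i..j]` is a surface in `s`. -/
def Surface (s : List α) (i j : ℕ) : Prop :=
  1 ≤ i ∧ i ≤ j ∧ j ≤ s.length ∧ (substr s i j).Palindrome ∧
    (∀ l, 1 ≤ l → l < i → ¬ (substr s l j).Palindrome) ∧
    (∀ r, j < r → r ≤ s.length → ¬ (substr s i r).Palindrome)

/-- length of the longest proper palindromic suffix of `t`. -/
def linklen (t : List α) : ℕ :=
  sSup {l | l < t.length ∧ (t.drop (t.length - l)).Palindrome}

/-- the longest proper palindromic suffix of `t` (possibly `[]`). -/
def link (t : List α) : List α := t.drop (t.length - linklen t)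

/-- `overline-occ`: shifted occurrences `{i + |t| - |link t| : i ∈ occ s t}`. -/
def obar (s t : List α) : Set ℕ := (fun i => i + t.length - (link t).length) '' occ s t

/-- Eq.(★): the family `S` of reduced occurrence sets represents `occ` for `s`. -/
def SatStar (s : List α) (S : List α → Set ℕ) : Prop :=
  ∀ v, IsPalSub s v →
    occ s v = S v ∪ ⋃ u ∈ {u : List α | IsPalSub s u ∧ link u = v}, (occ s u ∪ obar s u)

/-- number of non-empty palindromic substrings of `s` linking to `v`. -/
def linkcnt (s v : List α) : ℕ := {u | IsPalSub s u ∧ link u = v}.ncard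

def precnt (s v : List α) : ℕ := {i | 1 ≤ i ∧ i ≤ s.length ∧ prepal s i = v}.ncard

def sufcnt (s v : List α) : ℕ := {i | 1 ≤ i ∧ i ≤ s.length ∧ sufpal s i = v}.ncard

def cnt (s v : List α) : ℕ := sufcnt s v

/-- surfaced occurrences of `v` in `s`. -/
def surf (s v : List α) : Set ℕ := {i ∈ occ s v | Surface s i (i + v.length - 1)}

def presurf (s : List α) (i : ℕ) : List α :=
  if Surface s i (i + prelen s i - 1) then prepal s i else []

def sufsurf (s : List α) (i : ℕ) : List α :=
  if Surface s (i + 1 - suflen s i) i then sufpal s i else []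

end DEE
namespace DEE

/-- `f` is symmetric on the interval `[i, j]`. -/
def SymOn {β : Type*} (f : ℕ → β) (i j : ℕ) : Prop :=
  ∀ x y, i ≤ x → x ≤ j → x + y = i + j → f x = f y

lemma SymOn.concentric {β : Type*} {f : ℕ → β} {i j i' j' : ℕ} (h : SymOn f i j)
    (hi : i ≤ i') (hc : i' + j' = i + j) : SymOn f i' j' :=
  fun x y hx hy hxy => h x y (by omega) (by omega) (by omega)

lemma SymOn.reflect {β : Type*} {f : ℕ → β} {l r i j i' j' : ℕ} (h : SymOn f l r)
    (hij : SymOn f i j) (hi : l ≤ i) (hj : j ≤ r) (hi' : i' + j = l + r) (hj' : j' + i = l + r) :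
    SymOn f i' j' := by
  intro x y hx hy hxy
  rw [h x (l + r - x) (by omega) (by omega) (by omega),
    h y (l + r - y) (by omega) (by omega) (by omega)]
  exact hij _ _ (by omega) (by omega) (by omega)

/-- Two palindromes with common start `l` and ends `b < r` force, at every start `a` in `[l, b]`,
a palindrome ending in `(b, r]`. -/
lemma SymOn.exists_right {β : Type*} {f : ℕ → β} {l b r a : ℕ} (hb : SymOn f l b)
    (hr : SymOn f l r) (hbr : b < r) (hla : l ≤ a) (hab : a ≤ b) :
    ∃ e, b < e ∧ e ≤ r ∧ SymOn f a e := by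
  induction hn : a - l using Nat.strong_induction_on generalizing l with
  | _ n ih =>
    by_cases h : b < l + r - a
    · exact ⟨l + r - a, h, by omega, hr.concentric hla (by omega)⟩
    · exact ih (a - (l + r - b)) (by omega)
        (hr.concentric (by omega) (by omega))
        (hr.reflect hb le_rfl (by omega) (by omega) (by omega)) (by omega) rfl

/-- Two palindromes with common end `r` and starts `l < b` force, at every end `c` in `[b, r]`,
a palindrome starting in `[l, b)`. -/
lemma SymOn.exists_left {β : Type*} {f : ℕ → β} {l b r c : ℕ} (hb : SymOn f b r)
    (hl : SymOn f l r) (hlb : l < b) (hbc : b ≤ c) (hcr : c ≤ r) :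
    ∃ e, l ≤ e ∧ e < b ∧ SymOn f e c := by
  induction hn : r - c using Nat.strong_induction_on generalizing r with
  | _ n ih =>
    by_cases h : l + r - c < b
    · exact ⟨l + r - c, by omega, h, hl.concentric (by omega) (by omega)⟩
    · exact ih (l + r - b - c) (by omega)
        (hl.concentric (by omega) (by omega))
        (hl.reflect hb (by omega) le_rfl (by omega) (by omega)) (by omega) rfl

lemma substr_length (s : List α) {i j : ℕ} (hi : 1 ≤ i) (hj : j ≤ s.length) :
    (substr s i j).length = j + 1 - i := by
  simp only [substr, List.length_take, List.length_drop]
  omega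

lemma palindrome_substr_iff (s : List α) {i j : ℕ} (hi : 1 ≤ i) (hj : j ≤ s.length) :
    (substr s i j).Palindrome ↔ SymOn (fun x => s[x - 1]?) i j := by
  have hlen := substr_length s hi hj
  have hget : ∀ k, k < j + 1 - i → (substr s i j)[k]? = s[i + k - 1]? := by
    intro k hk
    rw [substr, List.getElem?_take_of_lt hk, List.getElem?_drop]
    congr 1
    omega
  rw [List.Palindrome.iff_reverse_eq]
  constructor
  · intro h x y hx hy hxy
    have h1 := hget (x - i) (by omega)
    have h2 := hget (y - i) (by omega)
    rw [← h, List.getElem?_reverse (by omega), hlen,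
      show j + 1 - i - 1 - (x - i) = y - i by omega, h2] at h1
    rw [show i + (x - i) - 1 = x - 1 by omega, show i + (y - i) - 1 = y - 1 by omega] at h1
    exact h1.symm
  · intro h
    apply List.ext_getElem?
    intro k
    by_cases hk : k < j + 1 - i
    · rw [List.getElem?_reverse (by omega), hlen, hget _ hk, hget _ (by omega)]
      exact h (i + (j + 1 - i - 1 - k)) (i + k) (by omega) (by omega) (by omega)
    · rw [List.getElem?_eq_none (by simp; omega), List.getElem?_eq_none (by omega)]

lemma substr_dropLast (s : List α) {i j : ℕ} (hi : 1 ≤ i) (hj : j ≤ s.length - 1) :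
    substr s.dropLast i j = substr s i j := by
  rw [substr, substr, List.dropLast_eq_take, List.drop_take, List.take_take]
  congr 1
  omega

lemma palindrome_substr_self (s : List α) {i : ℕ} (hi : 1 ≤ i) (hin : i ≤ s.length) :
    (substr s i i).Palindrome := by
  rw [palindrome_substr_iff s hi hin]
  intro x y _ _ _
  obtain rfl : x = y := by omega
  rfl

lemma isGreatest_csSup_of_bdd {S : Set ℕ} (hS : S.Nonempty) {N : ℕ} (hN : ∀ x ∈ S, x ≤ N) :
    IsGreatest S (sSup S) :=
  ⟨Nat.sSup_mem hS ⟨N, hN⟩, fun _ hx => le_csSup ⟨N, hN⟩ hx⟩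

lemma prelen_isGreatest (s : List α) {i : ℕ} (hi : 1 ≤ i) (hin : i ≤ s.length) :
    IsGreatest {l | 1 ≤ l ∧ l ≤ s.length + 1 - i ∧ (substr s i (i + l - 1)).Palindrome}
      (prelen s i) :=
  isGreatest_csSup_of_bdd ⟨1, le_rfl, by omega, palindrome_substr_self s hi hin⟩
    fun _ hx => hx.2.1

lemma suflen_isGreatest (s : List α) {i : ℕ} (hi : 1 ≤ i) (hin : i ≤ s.length) :
    IsGreatest {l | 1 ≤ l ∧ l ≤ i ∧ (substr s (i + 1 - l) i).Palindrome} (suflen s i) :=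
  isGreatest_csSup_of_bdd ⟨1, le_rfl, hi, palindrome_substr_self s hi hin⟩ fun _ hx => hx.2.1

lemma linklen_isGreatest {t : List α} (ht : t ≠ []) :
    IsGreatest {l | l < t.length ∧ (t.drop (t.length - l)).Palindrome} (linklen t) := by
  refine isGreatest_csSup_of_bdd (N := t.length) ⟨0, List.length_pos_iff.mpr ht, ?_⟩
    fun _ hx => hx.1.le
  simpa using List.Palindrome.nil

lemma link_length (t : List α) (ht : t ≠ []) : (link t).length = linklen t := by
  have := (linklen_isGreatest ht).1.1
  rw [link, List.length_drop]
  omega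

lemma link_eq_take {t : List α} (ht : t ≠ []) (hp : t.Palindrome) :
    link t = t.take (link t).length := by
  have hl : (link t).Palindrome := (linklen_isGreatest ht).1.2
  have hlt := (linklen_isGreatest ht).1.1
  rw [link_length t ht]
  conv_lhs => rw [← hl.reverse_eq, link, List.reverse_drop, hp.reverse_eq]
  congr 1
  omega

lemma length_le_link_of_take {t : List α} (hp : t.Palindrome) {l : ℕ}
    (hl : l < t.length) (h : (t.take l).Palindrome) : l ≤ (link t).length := by
  have ht : t ≠ [] := by rintro rfl; simp at hl
  rw [link_length t ht]
  refine (linklen_isGreatest ht).2 ⟨hl, ?_⟩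
  rw [← List.reverse_reverse (t.drop _), List.reverse_drop, hp.reverse_eq,
    show t.length - (t.length - l) = l by omega, h.reverse_eq]
  exact h

lemma exists_presurf (s : List α) {i : ℕ} (hi : 1 ≤ i) (hin : i ≤ s.length) :
    ∃ j, i ≤ j ∧ j ≤ s.length ∧ (substr s i j).Palindrome ∧
      (∀ r, j < r → r ≤ s.length → ¬ (substr s i r).Palindrome) ∧
      presurf s i = if Surface s i j then substr s i j else [] := by
  obtain ⟨⟨h1, h2, h3⟩, h4⟩ := prelen_isGreatest s hi hin
  refine ⟨i + prelen s i - 1, by omega, by omega, h3, fun r hr hrn hp => ?_, rfl⟩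
  have := h4 (a := r + 1 - i) ⟨by omega, by omega, by
    rwa [show i + (r + 1 - i) - 1 = r by omega]⟩
  omega

lemma exists_sufsurf (s : List α) {i : ℕ} (hi : 1 ≤ i) (hin : i ≤ s.length) :
    ∃ l, 1 ≤ l ∧ l ≤ i ∧ (substr s l i).Palindrome ∧
      (∀ k, 1 ≤ k → k < l → ¬ (substr s k i).Palindrome) ∧
      sufpal s i = substr s l i ∧
      sufsurf s i = if Surface s l i then substr s l i else [] := by
  obtain ⟨⟨h1, h2, h3⟩, h4⟩ := suflen_isGreatest s hi hin
  refine ⟨i + 1 - suflen s i, by omega, by omega, h3, fun k hk hkl hp => ?_, rfl, rfl⟩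
  have := h4 (a := i + 1 - k) ⟨by omega, by omega, by
    rwa [show i + 1 - (i + 1 - k) = k by omega]⟩
  omega

lemma surface_dropLast_iff (s : List α) {i j : ℕ} (hj : j ≤ s.length - 1) :
    Surface s.dropLast i j ↔ 1 ≤ i ∧ i ≤ j ∧ (substr s i j).Palindrome ∧
      (∀ l, 1 ≤ l → l < i → ¬ (substr s l j).Palindrome) ∧
      (∀ r, j < r → r ≤ s.length - 1 → ¬ (substr s i r).Palindrome) := by
  rw [Surface, List.length_dropLast]
  constructor
  · rintro ⟨h1, h2, -, h4, h5, h6⟩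
    refine ⟨h1, h2, ?_, fun l hl hli => ?_, fun r hr hrn => ?_⟩
    · rwa [← substr_dropLast s h1 hj]
    · rw [← substr_dropLast s hl hj]; exact h5 l hl hli
    · rw [← substr_dropLast s h1 hrn]; exact h6 r hr hrn
  · rintro ⟨h1, h2, h4, h5, h6⟩
    refine ⟨h1, h2, hj, ?_, fun l hl hli => ?_, fun r hr hrn => ?_⟩
    · rwa [substr_dropLast s h1 hj]
    · rw [substr_dropLast s hl hj]; exact h5 l hl hli
    · rw [substr_dropLast s h1 hrn]; exact h6 r hr hrn

lemma exists_presurf_dropLast (s : List α) {i : ℕ} (hi : 1 ≤ i) (hin : i ≤ s.length - 1) :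
    ∃ j, i ≤ j ∧ j ≤ s.length - 1 ∧ (substr s i j).Palindrome ∧
      (∀ r, j < r → r ≤ s.length - 1 → ¬ (substr s i r).Palindrome) ∧
      presurf s.dropLast i = if Surface s.dropLast i j then substr s i j else [] := by
  obtain ⟨j, h1, h2, h3, h4, h5⟩ := exists_presurf s.dropLast hi (by simpa using hin)
  rw [List.length_dropLast] at h2 h4
  rw [substr_dropLast s hi h2] at h3 h5
  refine ⟨j, h1, h2, h3, fun r hr hrn => ?_, h5⟩
  rw [← substr_dropLast s hi hrn]
  exact h4 r hr hrn

lemma exists_sufsurf_dropLast (s : List α) {i : ℕ} (hi : 1 ≤ i) (hin : i ≤ s.length - 1) :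
    ∃ l, 1 ≤ l ∧ l ≤ i ∧ (substr s l i).Palindrome ∧
      (∀ k, 1 ≤ k → k < l → ¬ (substr s k i).Palindrome) ∧
      sufsurf s i = (if Surface s l i then substr s l i else []) ∧
      sufsurf s.dropLast i = if Surface s.dropLast l i then substr s l i else [] := by
  obtain ⟨l, h1, h2, h3, h4, -, h5⟩ := exists_sufsurf s hi (by omega)
  obtain ⟨l', h1', h2', h3', h4', -, h5'⟩ := exists_sufsurf s.dropLast hi (by simpa using hin)
  rw [substr_dropLast s h1' hin] at h3' h5'
  have hll : l = l' := by
    rcases lt_trichotomy l l' with h | h | h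
    · exact absurd (substr_dropLast s h1 hin ▸ h3) (h4' l h1 h)
    · exact h
    · exact absurd h3' (h4 l' h1' h)
  subst hll
  exact ⟨l, h1, h2, h3, h4, h5, h5'⟩

lemma substr_take (s : List α) {i j k : ℕ} (hi : 1 ≤ i) (hk : k ≤ j + 1 - i) :
    (substr s i j).take k = substr s i (i + k - 1) := by
  rw [substr, substr, List.take_take]
  congr 1
  omega

lemma palindrome_exists_right (s : List α) {l b r a : ℕ} (hl : 1 ≤ l) (hrn : r ≤ s.length)
    (hb : (substr s l b).Palindrome) (hr : (substr s l r).Palindrome) (hbr : b < r)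
    (hla : l ≤ a) (hab : a ≤ b) : ∃ e, b < e ∧ e ≤ r ∧ (substr s a e).Palindrome := by
  rw [palindrome_substr_iff s hl (by omega)] at hb hr
  obtain ⟨e, h1, h2, h3⟩ := hb.exists_right hr hbr hla hab
  exact ⟨e, h1, h2, (palindrome_substr_iff s (by omega) (by omega)).mpr h3⟩

lemma palindrome_exists_left (s : List α) {l b r c : ℕ} (hl : 1 ≤ l) (hrn : r ≤ s.length)
    (hb : (substr s b r).Palindrome) (hr : (substr s l r).Palindrome) (hlb : l < b)
    (hbc : b ≤ c) (hcr : c ≤ r) : ∃ e, l ≤ e ∧ e < b ∧ (substr s e c).Palindrome := by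
  rw [palindrome_substr_iff s (by omega) (by omega)] at hb hr
  obtain ⟨e, h1, h2, h3⟩ := hb.exists_left hr hlb hbc hcr
  exact ⟨e, h1, h2, (palindrome_substr_iff s (by omega) (by omega)).mpr h3⟩

end DEE

/-- (Surface recording for `pop_back`.) How `presurf` and `sufsurf`
change when the last character of non-empty `s` is removed, where `t` is the longest
palindromic suffix of `s`, `t' = link t` and `s' = s[1..|s|-1]`. -/
theorem surface_recording_pop_back {α : Type*} (s : List α) (hs : s ≠ [])
    (t t' : List α) (ht : t = DEE.sufpal s s.length) (ht' : t' = DEE.link t) :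
    ∀ i, 1 ≤ i → i ≤ s.dropLast.length →
      ((i = s.length - t.length + 1 →
          (DEE.sufsurf s (s.length - t.length + t'.length)).length < t'.length →
          DEE.presurf s.dropLast i = t') ∧
       (i = s.length - t.length + 1 →
          t'.length ≤ (DEE.sufsurf s (s.length - t.length + t'.length)).length →
          DEE.presurf s.dropLast i = []) ∧
       (i ≠ s.length - t.length + 1 → DEE.presurf s.dropLast i = DEE.presurf s i)) ∧
      ((i = s.length - t.length + t'.length ∧
          (DEE.sufsurf s (s.length - t.length + t'.length)).length < t'.length →
          DEE.sufsurf s.dropLast i = t') ∧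
       (¬ (i = s.length - t.length + t'.length ∧
            (DEE.sufsurf s (s.length - t.length + t'.length)).length < t'.length) →
          DEE.sufsurf s.dropLast i = DEE.sufsurf s i)) := by
  have hn : 1 ≤ s.length := List.length_pos_iff.mpr hs
  obtain ⟨a, ha1, han, hpal, hmin, hsuf, -⟩ := DEE.exists_sufsurf s hn le_rfl
  rw [hsuf] at ht
  have htlen : t.length = s.length + 1 - a := by rw [ht, DEE.substr_length s ha1 le_rfl]
  have htne : t ≠ [] := by
    rintro rfl
    simp at htlen
    omega
  have htp : t.Palindrome := ht ▸ hpal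
  have hmlt : t'.length < t.length := by
    rw [ht', DEE.link_length t htne]
    exact (DEE.linklen_isGreatest htne).1.1
  -- the prefix of the suffix palindrome that equals its link ends at position b
  obtain ⟨b, hb⟩ : ∃ b, b = s.length - t.length + t'.length := ⟨_, rfl⟩
  have hbn : b ≤ s.length - 1 := by omega
  have ht'b : t' = DEE.substr s a b := by
    rw [ht', DEE.link_eq_take htne htp, ← ht', ht, DEE.substr_take s ha1 (by omega)]
    congr 1
    omega
  have hpb : (DEE.substr s a b).Palindrome := by
    rw [← ht'b, ht']
    exact (DEE.linklen_isGreatest htne).1.2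
  have hmax : ∀ e, a ≤ e → e < s.length → (DEE.substr s a e).Palindrome → e ≤ b := by
    intro e hae hen hp
    have := DEE.length_le_link_of_take (l := e + 1 - a) htp (by omega) (by
      rw [ht, DEE.substr_take s ha1 (by omega)]
      rwa [show a + (e + 1 - a) - 1 = e by omega])
    rw [← ht'] at this
    omega
  have hnot : ∀ j, j < s.length → ¬ DEE.Surface s a j := fun j hj h =>
    h.2.2.2.2.2 s.length hj le_rfl hpal
  rw [← hb]
  have hshort : a ≤ b → (DEE.sufsurf s b).length < t'.length →
      ∀ l, 1 ≤ l → l < a → ¬ (DEE.substr s l b).Palindrome := by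
    intro hab' hlt k hk hka hkp
    obtain ⟨l, hl1, hlb, hlp, hlmin, hls⟩ := DEE.exists_sufsurf s (i := b) (by omega) (by omega)
    have hla : l ≤ k := not_lt.mp fun h => hlmin k hk h hkp
    have hns : ¬ DEE.Surface s l b := by
      intro h
      rw [hls.2, if_pos h, DEE.substr_length s hl1 (by omega)] at hlt
      omega
    apply hns
    refine ⟨hl1, hlb, by omega, hlp, hlmin, fun r hr hrn hp => ?_⟩
    have hrn' : r < s.length := lt_of_le_of_ne hrn fun h => hmin l hl1 (by omega) (h ▸ hp)
    obtain ⟨e, he1, he2, he3⟩ :=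
      DEE.palindrome_exists_right s hl1 hrn hlp hp hr (a := a) (by omega) hab'
    exact absurd (hmax e (by omega) (by omega) he3) (by omega)
  have hsurf : a ≤ b → (DEE.sufsurf s b).length < t'.length →
      DEE.Surface s.dropLast a b := by
    intro hab' hlt
    rw [DEE.surface_dropLast_iff s hbn]
    refine ⟨ha1, hab', hpb, hshort hab' hlt, fun r hr hrn hp => ?_⟩
    exact absurd (hmax r (by omega) (by omega) hp) (by omega)
  have hlong : a ≤ b → t'.length ≤ (DEE.sufsurf s b).length →
      ¬ ∀ l, 1 ≤ l → l < a → ¬ (DEE.substr s l b).Palindrome := by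
    intro hab' hle hno
    obtain ⟨l, hl1, hlb, hlp, hlmin, -, hls⟩ :=
      DEE.exists_sufsurf s (i := b) (by omega) (by omega)
    rw [hls] at hle
    split_ifs at hle with h
    · rw [DEE.substr_length s hl1 (by omega)] at hle
      have hla : l ≠ a := by
        rintro rfl
        exact hnot b (by omega) h
      exact hno l hl1 (by omega) hlp
    · simp at hle
      simp [hle] at hmlt hb
      omega
  intro i hi hin
  rw [List.length_dropLast] at hin
  have hia : s.length - t.length + 1 = a := by omega
  rw [hia]
  obtain ⟨j, hij, hjn, hjp, hjmax, hj⟩ := DEE.exists_presurf_dropLast s hi hin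
  obtain ⟨l, hl1, hli, hlp, hlmin, hls, hls'⟩ := DEE.exists_sufsurf_dropLast s hi hin
  have hjb : i = a → j = b := by
    rintro rfl
    refine le_antisymm (hmax j hij (by omega) hjp) (not_lt.mp fun h => hjmax b h hbn hpb)
  refine ⟨⟨fun hi' hlt => ?_, fun hi' hle => ?_, fun hne => ?_⟩, fun ⟨hi', hlt⟩ => ?_,
    fun hne => ?_⟩
  · obtain rfl := hjb hi'
    subst hi'
    rw [hj, if_pos (hsurf hij hlt), ht'b]
  · obtain rfl := hjb hi'
    subst hi'
    rw [hj, if_neg]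
    rw [DEE.surface_dropLast_iff s hbn]
    exact fun h => hlong hij hle h.2.2.2.1
  · obtain ⟨j', hij', hjn', hjp', hjmax', hj'⟩ := DEE.exists_presurf s hi (by omega)
    by_cases hin' : (DEE.substr s i s.length).Palindrome
    · have hai : a < i := by
        by_contra h
        exact hmin i hi (by omega) hin'
      obtain rfl : j' = s.length :=
        le_antisymm hjn' (not_lt.mp fun h => hjmax' _ h le_rfl hin')
      obtain ⟨e, he1, he2, he3⟩ :=
        DEE.palindrome_exists_left s ha1 le_rfl hin' hpal hai hij (by omega)
      rw [hj, hj', if_neg, if_neg]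
      · exact fun h => h.2.2.2.2.1 a ha1 hai hpal
      · rw [DEE.surface_dropLast_iff s hjn]
        exact fun h => h.2.2.2.1 e (by omega) he2 he3
    · have hjn'' : j' ≠ s.length := by
        rintro rfl
        exact hin' hjp'
      obtain rfl : j = j' :=
        le_antisymm (not_lt.mp fun h => hjmax' j h (by omega) hjp)
          (not_lt.mp fun h => hjmax j' h (by omega) hjp')
      have hiff : DEE.Surface s.dropLast i j ↔ DEE.Surface s i j := by
        rw [DEE.surface_dropLast_iff s hjn]
        exact ⟨fun h => ⟨hi, hij, hjn', hjp, h.2.2.2.1, hjmax'⟩,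
          fun h => ⟨hi, hij, hjp, h.2.2.2.2.1, hjmax⟩⟩
      simp only [hj, hj', hiff]
  · subst hi'
    have hab' : a ≤ i := by omega
    have hla : l = a := le_antisymm (not_lt.mp fun h => hlmin a ha1 h hpb)
      (not_lt.mp fun h => hshort hab' hlt l hl1 h hlp)
    subst hla
    rw [hls', if_pos (hsurf hab' hlt), ht'b]
  · have hiff : DEE.Surface s.dropLast l i ↔ DEE.Surface s l i := by
      rw [DEE.surface_dropLast_iff s hin]
      refine ⟨fun h => ⟨hl1, hli, by omega, hlp, hlmin, fun r hr hrn hp => ?_⟩,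
        fun h => ⟨hl1, hli, hlp, hlmin, fun r hr hrn => h.2.2.2.2.2 r hr (by omega)⟩⟩
      by_cases hrn' : r = s.length
      · subst hrn'
        rcases lt_trichotomy l a with hla | rfl | hla
        · exact hmin l hl1 hla hp
        · have hib : i = b := le_antisymm (hmax i hli (by omega) hlp)
            (not_lt.mp fun h' => h.2.2.2.2 b h' hbn hpb)
          subst hib
          exact hlong hli (not_lt.mp fun h' => hne ⟨rfl, h'⟩) hlmin
        · obtain ⟨e, he1, he2, he3⟩ :=
            DEE.palindrome_exists_left s ha1 le_rfl hp hpal hla hli hr.le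
          exact hlmin e (by omega) he2 he3
      · exact h.2.2.2.2 r hr (by omega) hp
    simp only [hls, hls', hiff]
end
end

section
/- Let Σ be an alphabet of size σ ≥ 2 and let s be a string over Σ of length n ≥ 1. Then there exists a palindrome t over Σ of length at most ⌈2·log_σ(n)⌉ + 1 that is not a substring of s; in other words, the shortest absent palindrome of s has length at most ⌈2·log_σ(n)⌉ + 1. -/
noncomputable section
open scoped Classical

/-- The palindrome of length `k` whose first half, rounded up, is `w`. -/
def palindromeOfHalf {α : Type*} (k : ℕ) (w : Fin ((k + 1) / 2) → α) : List α :=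
  List.ofFn fun i : Fin k => w ⟨min i (k - 1 - i), by omega⟩

theorem length_palindromeOfHalf {α : Type*} (k : ℕ) (w : Fin ((k + 1) / 2) → α) :
    (palindromeOfHalf k w).length = k := by
  simp [palindromeOfHalf]

theorem palindrome_palindromeOfHalf {α : Type*} (k : ℕ) (w : Fin ((k + 1) / 2) → α) :
    (palindromeOfHalf k w).Palindrome := by
  refine List.Palindrome.of_reverse_eq (List.ext_getElem (by simp) fun i hi _ => ?_)
  rw [List.length_reverse, length_palindromeOfHalf] at hi
  simp only [palindromeOfHalf, List.getElem_reverse, List.getElem_ofFn, List.length_ofFn]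
  congr 2
  omega

theorem palindromeOfHalf_injective {α : Type*} (k : ℕ) :
    Function.Injective (palindromeOfHalf (α := α) k) := by
  intro w w' h
  ext i
  have h' := congrFun (List.ofFn_injective h) ⟨i, by omega⟩
  have hi : min (i : ℕ) (k - 1 - i) = i := by omega
  simpa only [hi] using h'

/-- Fewer positions in `s` than palindromes of length `k` force one of the latter to be absent. -/
theorem exists_palindrome_length_eq_not_infix {α : Type*} [Fintype α] (s : List α) {k : ℕ}
    (hk : 0 < k) (h : s.length < Fintype.card α ^ ((k + 1) / 2)) :
    ∃ t : List α, t.Palindrome ∧ t.length = k ∧ ¬ t <:+: s := by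
  by_contra! hall
  have hpos : ∀ w : Fin ((k + 1) / 2) → α, ∃ p : Fin s.length,
      (s.drop p).take k = palindromeOfHalf k w := by
    intro w
    obtain ⟨a, b, hab⟩ :=
      hall _ (palindrome_palindromeOfHalf k w) (length_palindromeOfHalf k w)
    have hlen := congrArg List.length hab
    simp only [List.length_append, length_palindromeOfHalf] at hlen
    refine ⟨⟨a.length, by omega⟩, ?_⟩
    change (s.drop a.length).take k = _
    rw [← hab, List.append_assoc, List.drop_left, List.take_left' (length_palindromeOfHalf k w)]
  choose p hp using hpos
  have hinj : Function.Injective p := fun w w' hw =>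
    palindromeOfHalf_injective k (by rw [← hp w, ← hp w', hw])
  have hcard := Fintype.card_le_of_injective p hinj
  simp only [Fintype.card_fun, Fintype.card_fin] at hcard
  omega

theorem lt_pow_half_of_two_mul_logb_add_one_le {b n k : ℕ} (hb : 2 ≤ b) (hn : 1 ≤ n)
    (h : 2 * Real.logb b n + 1 ≤ k) : n < b ^ ((k + 1) / 2) := by
  have hb' : (1 : ℝ) < b := by exact_mod_cast hb
  have hn' : (0 : ℝ) < n := by exact_mod_cast hn
  have hk : (k : ℝ) ≤ 2 * ((k + 1) / 2 : ℕ) := by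
    exact_mod_cast (by omega : k ≤ 2 * ((k + 1) / 2))
  have hlog : Real.logb b n < ((k + 1) / 2 : ℕ) := by linarith
  rw [Real.logb_lt_iff_lt_rpow hb' hn', Real.rpow_natCast] at hlog
  exact_mod_cast hlog

/-- Over an alphabet of size `σ ≥ 2`, every string of length `n ≥ 1`
has an absent palindrome of length at most `⌈2 log_σ n⌉ + 1`. -/
theorem shortest_absent_palindrome_length {α : Type*} [Fintype α]
    (σ : ℕ) (hσ : Fintype.card α = σ) (hσ2 : 2 ≤ σ)
    (s : List α) (hn : 1 ≤ s.length) :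
    ∃ t : List α, t.Palindrome ∧
      (t.length : ℤ) ≤ ⌈(2 : ℝ) * Real.logb (σ : ℝ) (s.length : ℝ)⌉ + 1 ∧
      ¬ t <:+: s := by
  subst hσ
  have hlog : 0 ≤ Real.logb (Fintype.card α) s.length :=
    Real.logb_nonneg (by exact_mod_cast hσ2) (by exact_mod_cast hn)
  have hceil : 0 ≤ ⌈(2 : ℝ) * Real.logb (Fintype.card α) s.length⌉ :=
    Int.ceil_nonneg (by positivity)
  obtain ⟨m, hm⟩ := Int.eq_ofNat_of_zero_le hceil
  have hle : (2 : ℝ) * Real.logb (Fintype.card α) s.length ≤ m := by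
    exact_mod_cast Int.ceil_le.mp hm.le
  obtain ⟨t, ht, hlen, hts⟩ := exists_palindrome_length_eq_not_infix s m.succ_pos
    (lt_pow_half_of_two_mul_logb_add_one_le hσ2 hn (by push_cast; linarith))
  exact ⟨t, ht, by rw [hm, hlen]; push_cast; rfl, hts⟩
end
end
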